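/- Let p, q, r, s ∈ I be IRIs and ?x, ?y, ?z, ?u, ?v pairwise distinct variables. The pattern (?x, p, ?y) OPT ((?x, q, ?z) UNION (?x, r, ?u) UNION (?x, s, ?v)) is weakly monotonic. -/

import Mathlib

namespace SPARQL

/-- Kinds of RDF constants: IRIs, blank nodes, literals. -/
inductive Kind : Type
  | iri | blank | lit
deriving DecidableEq

/-- The countably infinite set `U` of constants, partitioned into the three
infinite sets of IRIs `I` (kind `iri`), blank nodes `B` (kind `blank`) and
literals `L` (kind `lit`). -/
abbrev Const := Kind × ℕ

/-- The countably infinite set `V` of variables (disjoint from `U`). -/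
abbrev Var := ℕ

/-- A mapping: a partial function from variables to constants with finite domain. -/
structure Mapping where
  toFun : Var → Option Const
  finite : {x : Var | toFun x ≠ none}.Finite

/-- The domain of a mapping. -/
def Mapping.dom (μ : Mapping) : Set Var := {x | μ.toFun x ≠ none}

/-- Two mappings are compatible if they agree on the intersection of their domains. -/
def Compatible (μ₁ μ₂ : Mapping) : Prop :=
  ∀ x ∈ μ₁.dom ∩ μ₂.dom, μ₁.toFun x = μ₂.toFun x

/-- Union of two mappings (preferring the first one where both are defined). -/
def Mapping.union (μ₁ μ₂ : Mapping) : Mapping where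
  toFun := fun x => match μ₁.toFun x with
    | some u => some u
    | none => μ₂.toFun x
  finite := by
    apply (μ₁.finite.union μ₂.finite).subset
    intro x hx
    simp only [Set.mem_setOf_eq] at hx
    simp only [Set.mem_union, Set.mem_setOf_eq]
    by_cases h1 : μ₁.toFun x = none
    · right; intro h2; apply hx; simp [h1, h2]
    · left; exact h1

/-- A term: either a constant or a variable. -/
inductive Term : Type
  | const : Const → Term
  | var : Var → Term

/-- A triple pattern. -/
abbrev TriplePat := Term × Term × Term

/-- An RDF graph: a finite set of triples of constants. -/
abbrev Graph := Finset (Const × Const × Const)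

/-- Variables of a term. -/
def Term.vars : Term → Set Var
  | .const _ => ∅
  | .var x => {x}

/-- Variables of a triple pattern. -/
def tripleVars (t : TriplePat) : Set Var := t.1.vars ∪ t.2.1.vars ∪ t.2.2.vars

/-- Apply a mapping to a term. -/
def Term.app (μ : Mapping) : Term → Option Const
  | .const c => some c
  | .var x => μ.toFun x

/-- Three truth values: true, false, error. -/
inductive TV : Type
  | t | f | e
deriving DecidableEq

/-- Kleene negation. -/
def TV.neg : TV → TV
  | .t => .f
  | .f => .t
  | .e => .e

/-- Kleene conjunction. -/
def TV.and : TV → TV → TV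
  | .f, _ => .f
  | _, .f => .f
  | .t, .t => .t
  | _, _ => .e

/-- Kleene disjunction. -/
def TV.or : TV → TV → TV
  | .t, _ => .t
  | _, .t => .t
  | .f, .f => .f
  | _, _ => .e

/-- Constraints: Boolean combinations of the atomic constraints
`bound(?x)`, `?x = c`, `?x = ?y`, `isIRI(?x)`, `isBlank(?x)`, `isLiteral(?x)`. -/
inductive Constraint : Type
  | bound : Var → Constraint
  | eqC : Var → Const → Constraint
  | eqV : Var → Var → Constraint
  | isIRI : Var → Constraint
  | isBlank : Var → Constraint
  | isLiteral : Var → Constraint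
  | and : Constraint → Constraint → Constraint
  | or : Constraint → Constraint → Constraint
  | not : Constraint → Constraint

/-- Three-valued evaluation of a constraint on a mapping. -/
def Constraint.eval (μ : Mapping) : Constraint → TV
  | .bound x => match μ.toFun x with
      | some _ => .t
      | none => .f
  | .eqC x c => match μ.toFun x with
      | some u => if u = c then .t else .f
      | none => .e
  | .eqV x y => match μ.toFun x, μ.toFun y with
      | some u, some v => if u = v then .t else .f
      | _, _ => .e
  | .isIRI x => match μ.toFun x with
      | some u => if u.1 = Kind.iri then .t else .f
      | none => .e
  | .isBlank x => match μ.toFun x with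
      | some u => if u.1 = Kind.blank then .t else .f
      | none => .e
  | .isLiteral x => match μ.toFun x with
      | some u => if u.1 = Kind.lit then .t else .f
      | none => .e
  | .and C D => (C.eval μ).and (D.eval μ)
  | .or C D => (C.eval μ).or (D.eval μ)
  | .not C => (C.eval μ).neg

/-- SPARQL graph patterns. -/
inductive Pattern : Type
  | triple : TriplePat → Pattern
  | and : Pattern → Pattern → Pattern
  | union : Pattern → Pattern → Pattern
  | opt : Pattern → Pattern → Pattern
  | filter : Pattern → Constraint → Pattern

/-- `μ(t) ∈ G` for a triple pattern `t`. -/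
def tripleMatch (μ : Mapping) (t : TriplePat) (G : Graph) : Prop :=
  ∃ s p o : Const, t.1.app μ = some s ∧ t.2.1.app μ = some p ∧ t.2.2.app μ = some o ∧
    (s, p, o) ∈ G

/-- Evaluation of a pattern on an RDF graph: a set of mappings. -/
def Pattern.eval (G : Graph) : Pattern → Set Mapping
  | .triple t => {μ | μ.dom = tripleVars t ∧ tripleMatch μ t G}
  | .and P₁ P₂ =>
      {μ | ∃ μ₁ ∈ P₁.eval G, ∃ μ₂ ∈ P₂.eval G, Compatible μ₁ μ₂ ∧ μ = μ₁.union μ₂}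
  | .union P₁ P₂ => P₁.eval G ∪ P₂.eval G
  | .opt P₁ P₂ =>
      {μ | ∃ μ₁ ∈ P₁.eval G, ∃ μ₂ ∈ P₂.eval G, Compatible μ₁ μ₂ ∧ μ = μ₁.union μ₂} ∪
      {μ₁ ∈ P₁.eval G | ∀ μ₂ ∈ P₂.eval G, ¬ Compatible μ₁ μ₂}
  | .filter P C => {μ ∈ P.eval G | C.eval μ = TV.t}

/-- A pattern is monotonic if enlarging the graph enlarges the answer set. -/
def Monotonic (P : Pattern) : Prop :=
  ∀ G₁ G₂ : Graph, G₁ ⊆ G₂ → P.eval G₁ ⊆ P.eval G₂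

/-- Subsumption of mappings: `μ₁ ⊑ μ₂`. -/
def Mapping.Sub (μ₁ μ₂ : Mapping) : Prop :=
  μ₁.dom ⊆ μ₂.dom ∧ ∀ x ∈ μ₁.dom, μ₁.toFun x = μ₂.toFun x

/-- Subsumption of sets of mappings: `Ω₁ ⊑ Ω₂`. -/
def SetSub (Ω₁ Ω₂ : Set Mapping) : Prop :=
  ∀ μ₁ ∈ Ω₁, ∃ μ₂ ∈ Ω₂, μ₁.Sub μ₂

/-- A pattern is weakly monotonic if enlarging the graph subsumes the old answers. -/
def WeaklyMonotonic (P : Pattern) : Prop :=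
  ∀ G₁ G₂ : Graph, G₁ ⊆ G₂ → SetSub (P.eval G₁) (P.eval G₂)

/-- Variables occurring in the triple patterns of a pattern. -/
def Pattern.vars : Pattern → Set Var
  | .triple t => tripleVars t
  | .and P Q => P.vars ∪ Q.vars
  | .union P Q => P.vars ∪ Q.vars
  | .opt P Q => P.vars ∪ Q.vars
  | .filter P _ => P.vars


theorem triple_mono (t : TriplePat) : Monotonic (Pattern.triple t) := by
  rintro G₁ G₂ h μ ⟨hd, a, b, c, h1, h2, h3, h4⟩
  exact ⟨hd, a, b, c, h1, h2, h3, h h4⟩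

theorem union_mono {P Q : Pattern} (hP : Monotonic P) (hQ : Monotonic Q) :
    Monotonic (Pattern.union P Q) := by
  intro G₁ G₂ h
  exact Set.union_subset_union (hP G₁ G₂ h) (hQ G₁ G₂ h)

theorem sub_refl_map (μ : Mapping) : μ.Sub μ := ⟨fun _ h => h, fun _ _ => rfl⟩

theorem sub_union_map (μ ν : Mapping) : μ.Sub (μ.union ν) := by
  have key : ∀ w ∈ μ.dom, μ.toFun w = (μ.union ν).toFun w := by
    intro w hw
    obtain ⟨c, hc⟩ := Option.ne_none_iff_exists'.mp hw
    simp [Mapping.union, hc]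
  refine ⟨fun w hw => ?_, key⟩
  change (μ.union ν).toFun w ≠ none
  rw [← key w hw]
  exact hw

theorem opt_weak {P Q : Pattern} (hP : Monotonic P) (hQ : Monotonic Q) :
    WeaklyMonotonic (Pattern.opt P Q) := by
  rintro G₁ G₂ h μ (⟨μ₁, h1, μ₂, h2, hc, rfl⟩ | ⟨h1, _⟩)
  · exact ⟨_, Or.inl ⟨μ₁, hP _ _ h h1, μ₂, hQ _ _ h h2, hc, rfl⟩, sub_refl_map _⟩
  · by_cases hex : ∃ μ₂ ∈ Q.eval G₂, Compatible μ μ₂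
    · obtain ⟨μ₂, h2, hc⟩ := hex
      exact ⟨_, Or.inl ⟨μ, hP _ _ h h1, μ₂, h2, hc, rfl⟩, sub_union_map _ _⟩
    · exact ⟨μ, Or.inr ⟨hP _ _ h h1, fun μ₂ h2 hc => hex ⟨μ₂, h2, hc⟩⟩, sub_refl_map _⟩

/-- for IRIs `p, q, r, s` and pairwise distinct variables
`?x, ?y, ?z, ?u, ?v`, the pattern
`(?x, p, ?y) OPT ((?x, q, ?z) UNION (?x, r, ?u) UNION (?x, s, ?v))`
is weakly monotonic. -/
theorem opt_union3_weaklyMonotonic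
    (p q r s : Const) (hp : p.1 = Kind.iri) (hq : q.1 = Kind.iri)
    (hr : r.1 = Kind.iri) (hs : s.1 = Kind.iri)
    (x y z u v : Var) (hdist : List.Pairwise (· ≠ ·) [x, y, z, u, v]) :
    WeaklyMonotonic (Pattern.opt
      (Pattern.triple (Term.var x, Term.const p, Term.var y))
      (Pattern.union
        (Pattern.union
          (Pattern.triple (Term.var x, Term.const q, Term.var z))
          (Pattern.triple (Term.var x, Term.const r, Term.var u)))
        (Pattern.triple (Term.var x, Term.const s, Term.var v)))) := by
  exact opt_weak (triple_mono _)
    (union_mono (union_mono (triple_mono _) (triple_mono _)) (triple_mono _))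

end SPARQL
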